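/- Let C be a Weyl-type tensor on V (dim V = n) and let f : Vᵏ → ℝ be an alternating k-linear map with 2 ≤ k ≤ n−1. Then G := C◊f (which by construction is alternating in (c₁,c₂) and in (a₁,…,aₖ)) satisfies: (a) for each fixed c₁, the normalized alternation of G over the k+1 arguments (c₂,a₁,…,aₖ) vanishes; (b) for each fixed aₖ, the normalized alternation of G over the k+1 arguments (c₁,c₂,a₁,…,a_{k−1}) vanishes; and (c) G is trace-free: Σ_{i=1}^{n} G(eᵢ,c₂,eᵢ,a₂,…,aₖ) = 0 for all c₂,a₂,…,aₖ ∈ V. That is, C◊f lies in the space E(2,k)₀ of completely trace-free tensors with the symmetries of E(2,k). -/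

import Mathlib

open scoped RealInnerProductSpace BigOperators

noncomputable section

/-- Euclidean `n`-space, the model inner product space `V` with orthonormal basis. -/
abbrev Euc (n : ℕ) : Type := EuclideanSpace ℝ (Fin n)

/-- The standard orthonormal basis vector `eᵢ`. -/
def eb (n : ℕ) (i : Fin n) : Euc n := EuclideanSpace.single i (1 : ℝ)

/-- Normalized alternation of an `m`-argument function over all its arguments. -/
def altFn {X : Type*} {m : ℕ} (g : (Fin m → X) → ℝ) (v : Fin m → X) : ℝ :=
  (1 / (m.factorial : ℝ)) *
    ∑ π : Equiv.Perm (Fin m), ((Equiv.Perm.sign π : ℤ) : ℝ) * g (v ∘ π)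

/-- The tuple `(c, d₁, …, d_{k-1})`. -/
def consCast {X : Type*} {k : ℕ} (c : X) (d : Fin (k - 1) → X) (j : Fin k) : X :=
  if h : (j : ℕ) = 0 then c else d ⟨(j : ℕ) - 1, by have := j.isLt; omega⟩

/-- A Weyl-type tensor: a 4-linear map antisymmetric in the first two and in the last
two arguments, satisfying the first Bianchi identity, and trace-free. -/
def IsWeyl {n : ℕ} (C : MultilinearMap ℝ (fun _ : Fin 4 => Euc n) ℝ) : Prop :=
  (∀ x y z w : Euc n, C ![x, y, z, w] = -C ![y, x, z, w]) ∧
  (∀ x y z w : Euc n, C ![x, y, z, w] = -C ![x, y, w, z]) ∧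
  (∀ x y z w : Euc n, C ![x, y, z, w] + C ![y, z, x, w] + C ![z, x, y, w] = 0) ∧
  (∀ x y : Euc n, ∑ i : Fin n, C ![eb n i, x, eb n i, y] = 0)

/-- The action `C♦f` ("black lozenge") of a Weyl-type tensor on an alternating
`k`-linear `f` (`k ≥ 2`):
`(C♦f)(c,a₂,…,a_k) = ((k-2)/k)·Alt_{(a₂,…,a_k)}[Σ_{p,q} C(c,a₂,e_p,e_q) f(e_p,e_q,a₃,…,a_k)
 + Σ_{p,q} C(a₃,a₂,e_p,e_q) f(e_p,e_q,c,a₄,…,a_k)]` (second term absent for `k = 2`). -/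
def lozB {n k : ℕ} (hk : 2 ≤ k) (C : MultilinearMap ℝ (fun _ : Fin 4 => Euc n) ℝ)
    (f : (Euc n) [⋀^Fin k]→ₗ[ℝ] ℝ) (c : Euc n) (a : Fin (k - 1) → Euc n) : ℝ :=
  (((k : ℝ) - 2) / (k : ℝ)) *
    altFn (fun a' =>
      (∑ p : Fin n, ∑ q : Fin n,
        C ![c, a' ⟨0, by omega⟩, eb n p, eb n q] *
          f (fun i : Fin k =>
            if h0 : (i : ℕ) = 0 then eb n p
            else if h1 : (i : ℕ) = 1 then eb n q
            else a' ⟨(i : ℕ) - 1, by have := i.isLt; omega⟩)) +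
      (if h3 : 3 ≤ k then
        ∑ p : Fin n, ∑ q : Fin n,
          C ![a' ⟨1, by omega⟩, a' ⟨0, by omega⟩, eb n p, eb n q] *
            f (fun i : Fin k =>
              if h0 : (i : ℕ) = 0 then eb n p
              else if h1 : (i : ℕ) = 1 then eb n q
              else if h2 : (i : ℕ) = 2 then c
              else a' ⟨(i : ℕ) - 1, by have := i.isLt; omega⟩)
      else 0)) a


/-- The action `C◊f` ("white lozenge") of a Weyl-type tensor on an alternating
`k`-linear `f` (`2 ≤ k`):
`(C◊f)(c₁,c₂,a₁,…,a_k) = Alt_{(c₁,c₂)} Alt_{(a₁,…,a_k)}[Σ_p C(c₁,c₂,a₁,e_p) f(e_p,a₂,…,a_k)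
 + Σ_p C(a₁,a₂,c₁,e_p) f(e_p,c₂,a₃,…,a_k) + (k/(n-k)) ⟨c₁,a₁⟩ (C♦f)(c₂,a₂,…,a_k)]`. -/
def lozW {n k : ℕ} (hk : 2 ≤ k) (C : MultilinearMap ℝ (fun _ : Fin 4 => Euc n) ℝ)
    (f : (Euc n) [⋀^Fin k]→ₗ[ℝ] ℝ) (c₁ c₂ : Euc n) (a : Fin k → Euc n) : ℝ :=
  (1 / 2) *
    (altFn (fun a' =>
        (∑ p : Fin n,
          C ![c₁, c₂, a' ⟨0, by omega⟩, eb n p] *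
            f (fun i : Fin k => if (i : ℕ) = 0 then eb n p else a' i)) +
        (∑ p : Fin n,
          C ![a' ⟨0, by omega⟩, a' ⟨1, by omega⟩, c₁, eb n p] *
            f (fun i : Fin k =>
              if (i : ℕ) = 0 then eb n p else if (i : ℕ) = 1 then c₂ else a' i)) +
        ((k : ℝ) / ((n : ℝ) - (k : ℝ))) * ⟪c₁, a' ⟨0, by omega⟩⟫ *
          lozB hk C f c₂ (fun j => a' ⟨(j : ℕ) + 1, by have := j.isLt; omega⟩)) a -
     altFn (fun a' =>
        (∑ p : Fin n,
          C ![c₂, c₁, a' ⟨0, by omega⟩, eb n p] *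
            f (fun i : Fin k => if (i : ℕ) = 0 then eb n p else a' i)) +
        (∑ p : Fin n,
          C ![a' ⟨0, by omega⟩, a' ⟨1, by omega⟩, c₂, eb n p] *
            f (fun i : Fin k =>
              if (i : ℕ) = 0 then eb n p else if (i : ℕ) = 1 then c₁ else a' i)) +
        ((k : ℝ) / ((n : ℝ) - (k : ℝ))) * ⟪c₂, a' ⟨0, by omega⟩⟫ *
          lozB hk C f c₁ (fun j => a' ⟨(j : ℕ) + 1, by have := j.isLt; omega⟩)) a)


section Alternation

variable {X : Type*}

theorem altFn_add {m : ℕ} (g h : (Fin m → X) → ℝ) (v : Fin m → X) :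
    altFn (fun w => g w + h w) v = altFn g v + altFn h v := by
  simp only [altFn, mul_add, Finset.sum_add_distrib]

theorem altFn_sub {m : ℕ} (g h : (Fin m → X) → ℝ) (v : Fin m → X) :
    altFn (fun w => g w - h w) v = altFn g v - altFn h v := by
  simp only [altFn, mul_sub, Finset.sum_sub_distrib]

theorem altFn_const_mul {m : ℕ} (r : ℝ) (g : (Fin m → X) → ℝ) (v : Fin m → X) :
    altFn (fun w => r * g w) v = r * altFn g v := by
  simp only [altFn, Finset.mul_sum]
  exact Finset.sum_congr rfl fun π _ => by ring

theorem altFn_zero {m : ℕ} (v : Fin m → X) : altFn (fun _ => 0) v = 0 := by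
  simp [altFn]

theorem altFn_sum {m : ℕ} {ι : Type*} (s : Finset ι) (g : ι → (Fin m → X) → ℝ)
    (v : Fin m → X) :
    altFn (fun w => ∑ i ∈ s, g i w) v = ∑ i ∈ s, altFn (g i) v := by
  simp only [altFn, Finset.mul_sum]
  exact Finset.sum_comm

theorem altFn_comp_perm {m : ℕ} (σ : Equiv.Perm (Fin m)) (g : (Fin m → X) → ℝ)
    (v : Fin m → X) :
    altFn (fun w => g (w ∘ σ)) v = ((Equiv.Perm.sign σ : ℤ) : ℝ) * altFn g v := by
  have hs : ((Equiv.Perm.sign σ : ℤ) : ℝ) * ((Equiv.Perm.sign σ : ℤ) : ℝ) = 1 := by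
    norm_cast
    simp
  rw [← altFn_const_mul]
  unfold altFn
  congr 1
  refine Fintype.sum_equiv (Equiv.mulRight σ) _ _ fun π => ?_
  simp only [Equiv.coe_mulRight, Equiv.Perm.sign_mul, Units.val_mul, Int.cast_mul,
    Equiv.Perm.coe_mul, Function.comp_assoc]
  linear_combination (-((Equiv.Perm.sign π : ℤ) : ℝ) * g (v ∘ π ∘ σ)) * hs

theorem altFn_apply_comp_perm {m : ℕ} (σ : Equiv.Perm (Fin m)) (g : (Fin m → X) → ℝ)
    (v : Fin m → X) :
    altFn g (v ∘ σ) = ((Equiv.Perm.sign σ : ℤ) : ℝ) * altFn g v := by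
  have hs : ((Equiv.Perm.sign σ : ℤ) : ℝ) * ((Equiv.Perm.sign σ : ℤ) : ℝ) = 1 := by
    norm_cast
    simp
  rw [← altFn_const_mul]
  unfold altFn
  congr 1
  refine Fintype.sum_equiv (Equiv.mulLeft σ) _ _ fun π => ?_
  simp only [Equiv.coe_mulLeft, Equiv.Perm.sign_mul, Units.val_mul, Int.cast_mul,
    Equiv.Perm.coe_mul, Function.comp_assoc]
  linear_combination (-((Equiv.Perm.sign π : ℤ) : ℝ) * g (v ∘ σ ∘ π)) * hs

theorem altFn_eq_neg_of_swap {m : ℕ} {i j : Fin m} (hij : i ≠ j) {g h : (Fin m → X) → ℝ}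
    (H : ∀ w, g (w ∘ Equiv.swap i j) = h w) (v : Fin m → X) : altFn g v = -altFn h v := by
  have := altFn_comp_perm (Equiv.swap i j) g v
  rw [Equiv.Perm.sign_swap hij] at this
  simp only [H] at this
  push_cast at this
  linarith

/-- A function of tuples that transforms by the sign under permutations is its own alternation. -/
theorem altFn_eq_self {m : ℕ} {g : (Fin m → X) → ℝ}
    (H : ∀ (σ : Equiv.Perm (Fin m)) w, g (w ∘ σ) = ((Equiv.Perm.sign σ : ℤ) : ℝ) * g w)
    (v : Fin m → X) : altFn g v = g v := by
  have hs : ∀ σ : Equiv.Perm (Fin m),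
      ((Equiv.Perm.sign σ : ℤ) : ℝ) * (((Equiv.Perm.sign σ : ℤ) : ℝ) * g v) = g v := by
    intro σ
    rw [← mul_assoc]
    norm_cast
    simp
  have hm : (m.factorial : ℝ) ≠ 0 := by exact_mod_cast m.factorial_ne_zero
  simp only [altFn, H, hs, Finset.sum_const, Finset.card_univ, Fintype.card_perm,
    Fintype.card_fin, nsmul_eq_mul]
  field_simp

theorem cons_comp_decomposeFin {m : ℕ} (x : X) (d : Fin m → X) (σ : Equiv.Perm (Fin m)) :
    (Fin.cons x d : Fin (m + 1) → X) ∘ Equiv.Perm.decomposeFin.symm (0, σ) =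
      Fin.cons x (d ∘ σ) := by
  funext i
  refine Fin.cases ?_ (fun j => ?_) i <;> simp

theorem altFn_nested {m : ℕ} (h : X → (Fin m → X) → ℝ) (v : Fin (m + 1) → X) :
    altFn (fun w => altFn (h (w 0)) (Fin.tail w)) v =
      altFn (fun w => h (w 0) (Fin.tail w)) v := by
  have hm : (m.factorial : ℝ) ≠ 0 := by exact_mod_cast m.factorial_ne_zero
  have key : ∀ σ : Equiv.Perm (Fin m),
      altFn (fun w : Fin (m + 1) → X =>
        ((Equiv.Perm.sign σ : ℤ) : ℝ) * h (w 0) (Fin.tail w ∘ σ)) v =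
      altFn (fun w => h (w 0) (Fin.tail w)) v := by
    intro σ
    have := altFn_comp_perm (Equiv.Perm.decomposeFin.symm (0, σ))
      (fun w : Fin (m + 1) → X => h (w 0) (Fin.tail w)) v
    have e : ∀ w : Fin (m + 1) → X, w ∘ Equiv.Perm.decomposeFin.symm (0, σ) =
        Fin.cons (w 0) (Fin.tail w ∘ σ) := fun w => by
      conv_lhs => rw [← Fin.cons_self_tail w]
      exact cons_comp_decomposeFin _ _ _
    simp only [e, Fin.cons_zero, Fin.tail_cons] at this
    rw [altFn_const_mul, this, Equiv.Perm.decomposeFin.symm_sign, if_pos rfl, one_mul,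
      ← mul_assoc]
    norm_cast
    simp
  conv_lhs =>
    enter [1, w]
    rw [altFn]
  rw [altFn_const_mul, altFn_sum, Finset.sum_congr rfl fun σ _ => key σ]
  simp only [Finset.sum_const, Finset.card_univ, Fintype.card_perm, Fintype.card_fin,
    nsmul_eq_mul]
  field_simp

theorem cons_comp_swap {m : ℕ} (x : X) (d : Fin m → X) (j : Fin m) :
    (Fin.cons x d : Fin (m + 1) → X) ∘ Equiv.swap 0 j.succ =
      Fin.cons (d j) (Function.update d j x) := by
  funext i
  refine Fin.cases (by simp) (fun l => ?_) i
  by_cases hl : l = j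
  · subst hl
    simp
  · have h1 : (l.succ : Fin (m + 1)) ≠ 0 := Fin.succ_ne_zero l
    have h2 : (l.succ : Fin (m + 1)) ≠ j.succ := fun h => hl (Fin.succ_injective _ h)
    simp [Equiv.swap_apply_of_ne_of_ne h1 h2, Function.update_of_ne hl]

theorem update_zero_eq_cons {m : ℕ} (d : Fin (m + 1) → X) (x : X) :
    Function.update d 0 x = Fin.cons x (Fin.tail d) := by
  conv_lhs => rw [← Fin.cons_self_tail d, Fin.update_cons_zero]

theorem update_eq_cons_comp_swap {m : ℕ} (d : Fin (m + 1) → X) (j : Fin (m + 1)) (x : X) :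
    Function.update d j x =
      (Fin.cons x (Fin.tail (d ∘ Equiv.swap 0 j)) : Fin (m + 1) → X) ∘ Equiv.swap 0 j := by
  rw [← update_zero_eq_cons, Function.update_comp_equiv, Function.comp_assoc,
    ← Equiv.coe_trans, ← Equiv.Perm.mul_def, Equiv.swap_mul_self]
  simp

/-- Expansion of an alternation along the position taken by the first argument. -/
theorem altFn_cons {m : ℕ} (g : (Fin (m + 1) → X) → ℝ) (x : X) (d : Fin m → X) :
    altFn g (Fin.cons x d) = (1 / ((m : ℝ) + 1)) *
      (altFn (fun d' => g (Fin.cons x d')) d -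
        ∑ j : Fin m, altFn (fun d' => g (Fin.cons (d' j) (Function.update d' j x))) d) := by
  have hm : (m.factorial : ℝ) ≠ 0 := by exact_mod_cast m.factorial_ne_zero
  have hm1 : (m : ℝ) + 1 ≠ 0 := by positivity
  have e1 : ∀ σ : Equiv.Perm (Fin m), (Equiv.Perm.decomposeFin.symm (0, σ⁻¹))⁻¹ =
      Equiv.Perm.decomposeFin.symm (0, σ) := by
    intro σ
    rw [inv_eq_iff_mul_eq_one]
    ext i
    refine Fin.cases ?_ (fun j => ?_) i <;> simp
  have e2 : ∀ (p : Fin (m + 1)) (σ : Equiv.Perm (Fin m)),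
      (Fin.cons x d : Fin (m + 1) → X) ∘
        ((Equiv.Perm.decomposeFin.symm (p, σ⁻¹))⁻¹ : Equiv.Perm (Fin (m + 1))) =
      (Fin.cons x (d ∘ σ) : Fin (m + 1) → X) ∘ Equiv.swap 0 p := by
    intro p σ
    have : Equiv.Perm.decomposeFin.symm (p, σ⁻¹) =
        Equiv.swap 0 p * Equiv.Perm.decomposeFin.symm (0, σ⁻¹) := by
      ext i
      refine Fin.cases ?_ (fun j => ?_) i <;> simp
    rw [this, mul_inv_rev, Equiv.swap_inv, e1 σ, Equiv.Perm.coe_mul, ← Function.comp_assoc,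
      cons_comp_decomposeFin]
  have e : ∑ π : Equiv.Perm (Fin (m + 1)),
      ((Equiv.Perm.sign π : ℤ) : ℝ) * g ((Fin.cons x d : Fin (m + 1) → X) ∘ π) =
      ∑ q : Fin (m + 1) × Equiv.Perm (Fin m), (if q.1 = 0 then 1 else -1) *
        (((Equiv.Perm.sign q.2 : ℤ) : ℝ) *
          g ((Fin.cons x (d ∘ q.2) : Fin (m + 1) → X) ∘ Equiv.swap 0 q.1)) := by
    symm
    refine Fintype.sum_equiv (((Equiv.prodCongr (Equiv.refl _) (Equiv.inv _)).trans
      Equiv.Perm.decomposeFin.symm).trans (Equiv.inv _)) _ _ fun q => ?_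
    obtain ⟨p, σ⟩ := q
    simp only [Equiv.trans_apply, Equiv.prodCongr_apply, Prod.map, Equiv.coe_refl, id,
      Equiv.inv_apply, e2, Equiv.Perm.sign_inv, Equiv.Perm.decomposeFin.symm_sign]
    split_ifs <;> simp
  unfold altFn
  rw [e, Fintype.sum_prod_type, Fin.sum_univ_succ]
  simp only [if_true, Fin.succ_ne_zero, if_false, cons_comp_swap, Equiv.swap_self,
    Equiv.coe_refl, Function.comp_id, ← Finset.mul_sum, Nat.factorial_succ, Function.comp_apply]
  push_cast
  field_simp
  ring

/-- The position of an argument may be moved to the front inside an alternation. -/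
theorem altFn_update {m : ℕ} {φ : X → (Fin (m + 1) → X) → ℝ}
    (H : ∀ y (σ : Equiv.Perm (Fin (m + 1))) w,
      φ y (w ∘ σ) = ((Equiv.Perm.sign σ : ℤ) : ℝ) * φ y w)
    (x : X) (d : Fin (m + 1) → X) (j : Fin (m + 1)) :
    altFn (fun d' => φ (d' j) (Function.update d' j x)) d =
      altFn (fun d' => φ (d' 0) (Function.update d' 0 x)) d := by
  by_cases hj : j = 0
  · rw [hj]
  have := altFn_eq_neg_of_swap (Ne.symm hj)
    (g := fun d' => φ (d' j) (Function.update d' j x))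
    (h := fun d' => -φ (d' 0) (Function.update d' 0 x)) (fun w => ?_) d
  · rw [this, show (fun d' : Fin (m + 1) → X => -φ (d' 0) (Function.update d' 0 x)) =
      fun d' => (-1) * φ (d' 0) (Function.update d' 0 x) by funext; ring, altFn_const_mul]
    ring
  · have e : Function.update (w ∘ Equiv.swap 0 j) j x =
        Function.update w 0 x ∘ Equiv.swap 0 j := by
      rw [Function.update_comp_equiv]
      simp
    simp only [e, H, Equiv.Perm.sign_swap (Ne.symm hj)]
    simp

theorem altFn_cons_of_alternating {m : ℕ} {φ : X → (Fin (m + 1) → X) → ℝ}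
    (H : ∀ y (σ : Equiv.Perm (Fin (m + 1))) w,
      φ y (w ∘ σ) = ((Equiv.Perm.sign σ : ℤ) : ℝ) * φ y w)
    (x : X) (d : Fin (m + 1) → X) :
    altFn (fun w : Fin (m + 2) → X => φ (w 0) (Fin.tail w)) (Fin.cons x d) =
      (1 / ((m : ℝ) + 2)) * (φ x d -
        ((m : ℝ) + 1) * altFn (fun d' => φ (d' 0) (Fin.cons x (Fin.tail d'))) d) := by
  rw [altFn_cons]
  simp only [Fin.cons_zero, Fin.tail_cons, altFn_update H, altFn_eq_self (H x),
    update_zero_eq_cons, Finset.sum_const, Finset.card_univ, Fintype.card_fin, nsmul_eq_mul]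
  push_cast
  ring

end Alternation

theorem altFn_fixed_last_argument {X : Type*} {m : ℕ} {G : X → X → (Fin (m + 2) → X) → ℝ}
    (hskew : ∀ x y u, G x y u = -G y x u)
    (halt : ∀ x y (σ : Equiv.Perm (Fin (m + 2))) u,
      G x y (u ∘ σ) = ((Equiv.Perm.sign σ : ℤ) : ℝ) * G x y u)
    (hzero : ∀ x (v : Fin (m + 3) → X), altFn (fun w => G x (w 0) (Fin.tail w)) v = 0)
    (z : X) (v : Fin (m + 3) → X) :
    altFn (fun w => G (w 0) (w 1) (Fin.snoc (α := fun _ => X) (Fin.tail (Fin.tail w)) z)) v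
      = 0 := by
  have hm : (m : ℝ) + 2 ≠ 0 := by positivity
  have hm' : (m : ℝ) + 3 ≠ 0 := by positivity
  have hcons : ∀ x (d : Fin (m + 2) → X),
      altFn (fun d' => G x (d' 0) (Fin.cons z (Fin.tail d'))) d =
        (-1 / ((m : ℝ) + 2)) * G z x d := by
    intro x d
    have := altFn_cons_of_alternating (halt x) z d
    rw [hzero, hskew x z] at this
    push_cast at this
    field_simp at this ⊢
    linear_combination this
  have hrot : ∀ w : Fin (m + 3) → X,
      G (w 0) (w 1) (Fin.snoc (α := fun _ => X) (Fin.tail (Fin.tail w)) z) =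
        ((Equiv.Perm.sign (finRotate (m + 2)) : ℤ) : ℝ) *
          G (w 0) (Fin.tail w 0) (Fin.cons z (Fin.tail (Fin.tail w))) := by
    intro w
    rw [Fin.snoc_eq_cons_rotate, ← halt]
    rfl
  simp only [hrot]
  rw [altFn_const_mul,
    ← altFn_nested (fun x d => G x (d 0) (Fin.cons z (Fin.tail d)))]
  simp only [hcons]
  rw [altFn_const_mul, hzero, mul_zero, mul_zero]

theorem AlternatingMap.curryLeft_curryLeft_swap {R M N : Type*} [CommRing R] [AddCommGroup M]
    [AddCommGroup N] [Module R M] [Module R N] {k : ℕ} (f : M [⋀^Fin (k + 2)]→ₗ[R] N)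
    (x y : M) :
    (f.curryLeft x).curryLeft y = -(f.curryLeft y).curryLeft x := by
  have h := f.curryLeft_same (x + y)
  simp only [map_add, AlternatingMap.curryLeft_add, LinearMap.add_apply,
    AlternatingMap.curryLeft_same, zero_add, add_zero] at h
  exact eq_neg_of_add_eq_zero_left (by rw [← h]; abel)

theorem curryLeft_cons {n k : ℕ} (f : Euc n [⋀^Fin (k + 1)]→ₗ[ℝ] ℝ) (x : Euc n)
    (u : Fin k → Euc n) : f (Fin.cons x u) = f.curryLeft x u := rfl

theorem AlternatingMap.map_perm_real {n k : ℕ} (f : Euc n [⋀^Fin k]→ₗ[ℝ] ℝ)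
    (σ : Equiv.Perm (Fin k)) (u : Fin k → Euc n) :
    f (u ∘ σ) = ((Equiv.Perm.sign σ : ℤ) : ℝ) * f u := by
  rw [f.map_perm, Units.smul_def, zsmul_eq_mul]

theorem sum_inner_mul_eb {n : ℕ} {L : Euc n → ℝ} (hL : IsLinearMap ℝ L) (x : Euc n) :
    ∑ i, ⟪x, eb n i⟫ * L (eb n i) = L x := by
  have h : x = ∑ i, ⟪x, eb n i⟫ • eb n i := by
    conv_lhs => rw [← (EuclideanSpace.basisFun (Fin n) ℝ).sum_repr' x]
    simp [eb, real_inner_comm]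
  conv_rhs => rw [h, ← hL.mk'_apply, map_sum]
  simp

theorem sum_inner_mul_eb' {n : ℕ} {L : Euc n → ℝ} (hL : IsLinearMap ℝ L) (x : Euc n) :
    ∑ i, ⟪eb n i, x⟫ * L (eb n i) = L x := by
  rw [← sum_inner_mul_eb hL x]
  exact Finset.sum_congr rfl fun i _ => by rw [real_inner_comm]

theorem inner_eb_self {n : ℕ} (i : Fin n) : ⟪eb n i, eb n i⟫ = (1 : ℝ) := by
  simp [eb]

namespace IsWeyl

variable {n : ℕ} {C : MultilinearMap ℝ (fun _ : Fin 4 => Euc n) ℝ}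

theorem pair_symm (hC : IsWeyl C) (x y z w : Euc n) : C ![x, y, z, w] = C ![z, w, x, y] := by
  obtain ⟨h1, h2, h3, -⟩ := hC
  linarith [h3 x y z w, h3 y z w x, h3 z w x y, h3 w x y z, h1 x y z w, h2 x y z w,
    h1 z w x y, h2 z w x y, h1 y z x w, h1 z x y w, h2 y z x w, h2 z x y w,
    h1 z w y x, h2 w y z x, h1 w y z x, h2 y z w x, h1 y z w x, h1 w x z y, h2 w x z y,
    h1 x z w y, h2 x z w y, h1 w x y z, h2 w x y z, h1 x y w z, h1 y w x z, h2 y w x z]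

theorem contract_skew (hC : IsWeyl C) {H : Fin n → Fin n → ℝ} (hH : ∀ i p, H i p = -H p i)
    (x a : Euc n) :
    ∑ i, ∑ p, C ![eb n i, x, a, eb n p] * H i p =
      (1 / 2) * ∑ i, ∑ p, C ![a, x, eb n i, eb n p] * H i p := by
  have h : ∑ i, ∑ p, C ![eb n i, x, a, eb n p] * H i p =
      ∑ i, ∑ p, -(C ![eb n p, x, a, eb n i] * H i p) := by
    rw [Finset.sum_comm]
    refine Finset.sum_congr rfl fun i _ => Finset.sum_congr rfl fun p _ => ?_
    rw [hH p i]
    ring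
  have h' : ∑ i, ∑ p, C ![a, x, eb n i, eb n p] * H i p =
      ∑ i, ∑ p, C ![eb n i, x, a, eb n p] * H i p +
        ∑ i, ∑ p, -(C ![eb n p, x, a, eb n i] * H i p) := by
    simp only [← Finset.sum_add_distrib]
    refine Finset.sum_congr rfl fun i _ => Finset.sum_congr rfl fun p _ => ?_
    rw [hC.pair_symm (eb n p) x a (eb n i)]
    linear_combination (H i p) * (hC.2.2.1 a x (eb n i) (eb n p)
      - hC.1 x (eb n i) a (eb n p) - hC.1 (eb n i) a x (eb n p)
      + hC.2.1 a (eb n i) x (eb n p))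
  rw [h', ← h]
  ring

theorem contract_cyclic (hC : IsWeyl C) {H : Fin n → Fin n → Fin n → ℝ}
    (hH : ∀ p q i, H p q i = H q i p) (x : Euc n) :
    ∑ i, ∑ p, ∑ q, C ![eb n i, x, eb n p, eb n q] * H p q i = 0 := by
  have rot : ∀ K : Fin n → Fin n → Fin n → ℝ,
      ∑ i, ∑ p, ∑ q, K i p q = ∑ i, ∑ p, ∑ q, K p q i := by
    intro K
    conv_rhs => rw [Finset.sum_comm]
    exact Finset.sum_congr rfl fun p _ => Finset.sum_comm
  have h1 : ∑ i, ∑ p, ∑ q, C ![eb n i, x, eb n p, eb n q] * H p q i =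
      ∑ i, ∑ p, ∑ q, C ![eb n p, x, eb n q, eb n i] * H p q i := by
    rw [rot]
    exact Finset.sum_congr rfl fun i _ => Finset.sum_congr rfl fun p _ =>
      Finset.sum_congr rfl fun q _ => by rw [hH p q i]
  have h2 : ∑ i, ∑ p, ∑ q, C ![eb n i, x, eb n p, eb n q] * H p q i =
      ∑ i, ∑ p, ∑ q, C ![eb n q, x, eb n i, eb n p] * H p q i := by
    rw [rot, rot]
    exact Finset.sum_congr rfl fun i _ => Finset.sum_congr rfl fun p _ =>
      Finset.sum_congr rfl fun q _ => by rw [hH p q i, hH q i p]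
  have h3 : ∑ i, ∑ p, ∑ q, C ![eb n i, x, eb n p, eb n q] * H p q i +
      ∑ i, ∑ p, ∑ q, C ![eb n p, x, eb n q, eb n i] * H p q i +
      ∑ i, ∑ p, ∑ q, C ![eb n q, x, eb n i, eb n p] * H p q i = 0 := by
    simp only [← Finset.sum_add_distrib]
    refine Finset.sum_eq_zero fun i _ => Finset.sum_eq_zero fun p _ =>
      Finset.sum_eq_zero fun q _ => ?_
    rw [hC.pair_symm (eb n i) x, hC.pair_symm (eb n p) x, hC.pair_symm (eb n q) x]
    linear_combination (H p q i) * hC.2.2.1 (eb n p) (eb n q) (eb n i) x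
  linarith

end IsWeyl

section BlackLozenge

variable {n l : ℕ}

/-- The full contraction `Σ C(c,a₀,e_p,e_q) f(e_p,e_q,a₁,…)`. -/
def lozBFst (C : MultilinearMap ℝ (fun _ : Fin 4 => Euc n) ℝ)
    (f : Euc n [⋀^Fin (l + 2)]→ₗ[ℝ] ℝ) (c : Euc n) (a : Fin (l + 1) → Euc n) : ℝ :=
  ∑ p, ∑ q, C ![c, a 0, eb n p, eb n q] *
    ((f.curryLeft (eb n p)).curryLeft (eb n q)) (Fin.tail a)

/-- The full contraction `Σ C(a₁,a₀,e_p,e_q) f(e_p,e_q,c,a₂,…)`. -/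
def lozBSnd (C : MultilinearMap ℝ (fun _ : Fin 4 => Euc n) ℝ)
    (f : Euc n [⋀^Fin (l + 3)]→ₗ[ℝ] ℝ) (c : Euc n) (a : Fin (l + 2) → Euc n) : ℝ :=
  ∑ p, ∑ q, C ![Fin.tail a 0, a 0, eb n p, eb n q] *
    (((f.curryLeft (eb n p)).curryLeft (eb n q)).curryLeft c) (Fin.tail (Fin.tail a))

theorem lozB_two {hk : 2 ≤ 2} (C : MultilinearMap ℝ (fun _ : Fin 4 => Euc n) ℝ)
    (f : Euc n [⋀^Fin 2]→ₗ[ℝ] ℝ) (c : Euc n) (a : Fin 1 → Euc n) :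
    lozB hk C f c a = 0 := by
  simp [lozB]

theorem lozB_add_three {hk : 2 ≤ l + 3} (C : MultilinearMap ℝ (fun _ : Fin 4 => Euc n) ℝ)
    (f : Euc n [⋀^Fin (l + 3)]→ₗ[ℝ] ℝ) (c : Euc n) (a : Fin (l + 2) → Euc n) :
    lozB hk C f c a = (((l : ℝ) + 1) / ((l : ℝ) + 3)) *
      (altFn (lozBFst C f c) a + altFn (lozBSnd C f c) a) := by
  rw [← altFn_add]
  unfold lozB
  congr 1
  · push_cast
    ring
  · have h3 : 3 ≤ l + 3 := by omega
    simp only [h3, dif_pos]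
    refine congrArg (fun g => altFn g a) (funext fun a' => ?_)
    unfold lozBFst lozBSnd
    congr 1
    · refine Finset.sum_congr rfl fun p _ => Finset.sum_congr rfl fun q _ => ?_
      congr 1
      rw [← curryLeft_cons, ← curryLeft_cons]
      congr 1
      funext i
      refine Fin.cases rfl (fun i => Fin.cases rfl (fun i => rfl) i) i
    · refine Finset.sum_congr rfl fun p _ => Finset.sum_congr rfl fun q _ => ?_
      congr 1
      rw [← curryLeft_cons, ← curryLeft_cons, ← curryLeft_cons]
      congr 1
      funext i
      refine Fin.cases rfl (fun i => Fin.cases rfl (fun i => Fin.cases rfl (fun i => rfl) i) i) i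

theorem lozB_perm {k : ℕ} (hk : 2 ≤ k) (C : MultilinearMap ℝ (fun _ : Fin 4 => Euc n) ℝ)
    (f : Euc n [⋀^Fin k]→ₗ[ℝ] ℝ) (c : Euc n) (σ : Equiv.Perm (Fin (k - 1)))
    (a : Fin (k - 1) → Euc n) :
    lozB hk C f c (a ∘ σ) = ((Equiv.Perm.sign σ : ℤ) : ℝ) * lozB hk C f c a := by
  unfold lozB
  rw [altFn_apply_comp_perm]
  ring

theorem isLinearMap_zero : IsLinearMap ℝ (fun _ : Euc n => (0 : ℝ)) := ⟨by simp, by simp⟩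

theorem IsLinearMap.add_real {g h : Euc n → ℝ} (hg : IsLinearMap ℝ g)
    (hh : IsLinearMap ℝ h) : IsLinearMap ℝ (fun x => g x + h x) :=
  ⟨fun x y => by rw [hg.map_add, hh.map_add]; ring,
    fun r x => by rw [hg.map_smul, hh.map_smul]; simp only [smul_eq_mul]; ring⟩

theorem IsLinearMap.const_mul {g : Euc n → ℝ} (r : ℝ) (hg : IsLinearMap ℝ g) :
    IsLinearMap ℝ (fun x => r * g x) :=
  ⟨fun x y => by rw [hg.map_add]; ring,
    fun s x => by rw [hg.map_smul]; simp only [smul_eq_mul]; ring⟩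

theorem IsLinearMap.mul_const {g : Euc n → ℝ} (r : ℝ) (hg : IsLinearMap ℝ g) :
    IsLinearMap ℝ (fun x => g x * r) := by
  simpa only [mul_comm] using hg.const_mul r

theorem IsLinearMap.finset_sum {ι : Type*} {s : Finset ι} {g : ι → Euc n → ℝ}
    (hg : ∀ i, IsLinearMap ℝ (g i)) : IsLinearMap ℝ (fun x => ∑ i ∈ s, g i x) :=
  ⟨fun x y => by simp only [(hg _).map_add, Finset.sum_add_distrib],
    fun r x => by simp only [(hg _).map_smul, Finset.smul_sum]⟩

theorem isLinearMap_altFn {m : ℕ} {g : Euc n → (Fin m → Euc n) → ℝ}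
    (hg : ∀ d, IsLinearMap ℝ (fun x => g x d)) (d : Fin m → Euc n) :
    IsLinearMap ℝ (fun x => altFn (g x) d) :=
  (IsLinearMap.finset_sum fun _ => (hg _).const_mul _).const_mul _

theorem isLinearMap_altFn_update {m : ℕ} {g : (Fin m → Euc n) → ℝ}
    (hg : ∀ j d, IsLinearMap ℝ (fun x => g (Function.update d j x))) (j : Fin m)
    (d : Fin m → Euc n) :
    IsLinearMap ℝ (fun x => altFn g (Function.update d j x)) := by
  unfold altFn
  simp only [Function.update_comp_equiv]
  exact (IsLinearMap.finset_sum fun _ => (hg _ _).const_mul _).const_mul _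

theorem isLinearMap_first (C : MultilinearMap ℝ (fun _ : Fin 4 => Euc n) ℝ) (y z w : Euc n) :
    IsLinearMap ℝ (fun x => C ![x, y, z, w]) := by
  have h : IsLinearMap ℝ (fun x => C (Function.update ![0, y, z, w] 0 x)) :=
    (C.toLinearMap ![0, y, z, w] 0).isLinear
  have e : ∀ x, Function.update ![0, y, z, w] 0 x = ![x, y, z, w] := by
    intro x
    ext i
    fin_cases i <;> rfl
  simpa only [e] using h

theorem isLinearMap_second (C : MultilinearMap ℝ (fun _ : Fin 4 => Euc n) ℝ) (x z w : Euc n) :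
    IsLinearMap ℝ (fun y => C ![x, y, z, w]) := by
  have h : IsLinearMap ℝ (fun y => C (Function.update ![x, 0, z, w] 1 y)) :=
    (C.toLinearMap ![x, 0, z, w] 1).isLinear
  have e : ∀ y, Function.update ![x, 0, z, w] 1 y = ![x, y, z, w] := by
    intro y
    ext i
    fin_cases i <;> rfl
  simpa only [e] using h

theorem AlternatingMap.isLinearMap_update {k : ℕ} (f : Euc n [⋀^Fin k]→ₗ[ℝ] ℝ)
    (j : Fin k) (d : Fin k → Euc n) : IsLinearMap ℝ (fun x => f (Function.update d j x)) :=
  ⟨fun x y => f.map_update_add d j x y, fun r x => f.map_update_smul d j r x⟩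

theorem AlternatingMap.isLinearMap_curryLeft {k : ℕ} (f : Euc n [⋀^Fin (k + 1)]→ₗ[ℝ] ℝ)
    (d : Fin k → Euc n) : IsLinearMap ℝ (fun x => f.curryLeft x d) :=
  ⟨fun x y => by simp, fun r x => by simp⟩

theorem isLinearMap_lozBFst_update (C : MultilinearMap ℝ (fun _ : Fin 4 => Euc n) ℝ)
    (f : Euc n [⋀^Fin (l + 2)]→ₗ[ℝ] ℝ) (c : Euc n) (j : Fin (l + 1))
    (d : Fin (l + 1) → Euc n) :
    IsLinearMap ℝ (fun x => lozBFst C f c (Function.update d j x)) := by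
  refine IsLinearMap.finset_sum fun p => IsLinearMap.finset_sum fun q => ?_
  refine Fin.cases ?_ (fun j => ?_) j
  · simp only [Function.update_self, Fin.tail_update_zero]
    exact (isLinearMap_second C _ _ _).mul_const _
  · simp only [Function.update_of_ne (Fin.succ_ne_zero _).symm, Fin.tail_update_succ]
    exact (AlternatingMap.isLinearMap_update _ _ _).const_mul _

theorem isLinearMap_lozBSnd_update (C : MultilinearMap ℝ (fun _ : Fin 4 => Euc n) ℝ)
    (f : Euc n [⋀^Fin (l + 3)]→ₗ[ℝ] ℝ) (c : Euc n) (j : Fin (l + 2))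
    (d : Fin (l + 2) → Euc n) :
    IsLinearMap ℝ (fun x => lozBSnd C f c (Function.update d j x)) := by
  refine IsLinearMap.finset_sum fun p => IsLinearMap.finset_sum fun q => ?_
  refine Fin.cases ?_ (fun j => ?_) j
  · simp only [Function.update_self, Fin.tail_update_zero]
    exact (isLinearMap_second C _ _ _).mul_const _
  · simp only [Function.update_of_ne (Fin.succ_ne_zero _).symm, Fin.tail_update_succ]
    refine Fin.cases ?_ (fun j => ?_) j
    · simp only [Function.update_self, Fin.tail_update_zero]
      exact (isLinearMap_first C _ _ _).mul_const _
    · simp only [Function.update_of_ne (Fin.succ_ne_zero _).symm, Fin.tail_update_succ]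
      exact (AlternatingMap.isLinearMap_update _ _ _).const_mul _

theorem isLinearMap_lozB {m : ℕ} {hk : 2 ≤ m + 2}
    (C : MultilinearMap ℝ (fun _ : Fin 4 => Euc n) ℝ)
    (f : Euc n [⋀^Fin (m + 2)]→ₗ[ℝ] ℝ) (d : Fin (m + 1) → Euc n) :
    IsLinearMap ℝ (fun c => lozB hk C f c d) := by
  rcases m with _ | l
  · simpa only [lozB_two] using isLinearMap_zero
  · simp only [lozB_add_three]
    refine ((isLinearMap_altFn (fun d => ?_) d).add_real
      (isLinearMap_altFn (fun d => ?_) d)).const_mul _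
    · exact IsLinearMap.finset_sum fun p => IsLinearMap.finset_sum fun q =>
        (isLinearMap_first C _ _ _).mul_const _
    · exact IsLinearMap.finset_sum fun p => IsLinearMap.finset_sum fun q =>
        (AlternatingMap.isLinearMap_curryLeft _ _).const_mul _

theorem isLinearMap_lozB_update {m : ℕ} {hk : 2 ≤ m + 2}
    (C : MultilinearMap ℝ (fun _ : Fin 4 => Euc n) ℝ)
    (f : Euc n [⋀^Fin (m + 2)]→ₗ[ℝ] ℝ) (c : Euc n) (j : Fin (m + 1))
    (d : Fin (m + 1) → Euc n) :
    IsLinearMap ℝ (fun x => lozB hk C f c (Function.update d j x)) := by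
  rcases m with _ | l
  · simpa only [lozB_two] using isLinearMap_zero
  · simp only [lozB_add_three]
    exact ((isLinearMap_altFn_update (isLinearMap_lozBFst_update C f c) j d).add_real
      (isLinearMap_altFn_update (isLinearMap_lozBSnd_update C f c) j d)).const_mul _

theorem curryLeft_cyclic (f : Euc n [⋀^Fin (l + 3)]→ₗ[ℝ] ℝ) (x y z : Euc n)
    (u : Fin l → Euc n) :
    ((f.curryLeft x).curryLeft y).curryLeft z u = ((f.curryLeft y).curryLeft z).curryLeft x u := by
  rw [f.curryLeft_curryLeft_swap x y, (f.curryLeft y).curryLeft_curryLeft_swap z x]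
  rw [show -(f.curryLeft y).curryLeft x = (-1 : ℝ) • (f.curryLeft y).curryLeft x from
      (neg_one_smul ℝ _).symm,
    AlternatingMap.curryLeft_smul]
  simp

variable {C : MultilinearMap ℝ (fun _ : Fin 4 => Euc n) ℝ}

theorem IsWeyl.apply_self (hC : IsWeyl C) (x z w : Euc n) : C ![x, x, z, w] = 0 := by
  linarith [hC.1 x x z w]

theorem IsWeyl.sum_lozBFst_update (hC : IsWeyl C) (f : Euc n [⋀^Fin (l + 3)]→ₗ[ℝ] ℝ)
    (j : Fin (l + 2)) (d : Fin (l + 2) → Euc n) :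
    ∑ i, lozBFst C f (eb n i) (Function.update d j (eb n i)) = 0 := by
  unfold lozBFst
  refine Fin.cases ?_ (fun j => ?_) j
  · simp [hC.apply_self]
  · simp only [Function.update_of_ne (Fin.succ_ne_zero _).symm, Fin.tail_update_succ]
    refine hC.contract_cyclic (H := fun p q i =>
      ((f.curryLeft (eb n p)).curryLeft (eb n q))
        (Function.update (Fin.tail d) j (eb n i))) (fun p q i => ?_) (d 0)
    simp only [update_eq_cons_comp_swap, AlternatingMap.map_perm_real, curryLeft_cons]
    rw [curryLeft_cyclic]

theorem IsWeyl.sum_lozBSnd_update (hC : IsWeyl C) (f : Euc n [⋀^Fin (l + 3)]→ₗ[ℝ] ℝ)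
    (j : Fin (l + 2)) (d : Fin (l + 2) → Euc n) :
    ∑ i, lozBSnd C f (eb n i) (Function.update d j (eb n i)) = 0 := by
  unfold lozBSnd
  refine Fin.cases ?_ (fun j => ?_) j
  · simp only [Function.update_self, Fin.tail_update_zero]
    have := hC.contract_cyclic (H := fun p q i =>
      (((f.curryLeft (eb n p)).curryLeft (eb n q)).curryLeft (eb n i))
        (Fin.tail (Fin.tail d))) (fun p q i => curryLeft_cyclic _ _ _ _ _) (Fin.tail d 0)
    simp only [hC.1 (Fin.tail d 0), neg_mul, Finset.sum_neg_distrib, this, neg_zero]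
  · simp only [Function.update_of_ne (Fin.succ_ne_zero _).symm, Fin.tail_update_succ]
    refine Fin.cases ?_ (fun j => ?_) j
    · simp only [Function.update_self, Fin.tail_update_zero]
      exact hC.contract_cyclic (H := fun p q i =>
        (((f.curryLeft (eb n p)).curryLeft (eb n q)).curryLeft (eb n i))
          (Fin.tail (Fin.tail d))) (fun p q i => curryLeft_cyclic _ _ _ _ _) (d 0)
    · simp only [Function.update_of_ne (Fin.succ_ne_zero _).symm, Fin.tail_update_succ]
      refine Finset.sum_eq_zero fun i _ => Finset.sum_eq_zero fun p _ =>
        Finset.sum_eq_zero fun q _ => ?_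
      rw [← curryLeft_cons, AlternatingMap.map_eq_zero_of_eq _ _ (i := 0) (j := j.succ)
        (by simp) (Fin.succ_ne_zero _).symm, mul_zero]

end BlackLozenge

section WhiteLozenge

variable {n m : ℕ} {hk : 2 ≤ m + 2} {C : MultilinearMap ℝ (fun _ : Fin 4 => Euc n) ℝ}

theorem IsWeyl.sum_lozB_cons (hC : IsWeyl C) (f : Euc n [⋀^Fin (m + 2)]→ₗ[ℝ] ℝ)
    (d : Fin m → Euc n) :
    ∑ i, lozB hk C f (eb n i) (Fin.cons (eb n i) d : Fin (m + 1) → Euc n) = 0 := by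
  rcases m with _ | l
  · simp [lozB_two]
  · have h : ∀ g : Euc n → (Fin (l + 2) → Euc n) → ℝ,
        (∀ j d, ∑ i, g (eb n i) (Function.update d j (eb n i)) = 0) →
        ∑ i, altFn (g (eb n i)) (Fin.cons (eb n i) d) = 0 := by
      intro g hg
      obtain ⟨D, hD⟩ : ∃ D : Fin (l + 2) → Euc n, ∀ x : Euc n,
          (Fin.cons x d : Fin (l + 2) → Euc n) = Function.update D 0 x :=
        ⟨Fin.cons 0 d, fun x => by simp⟩
      simp only [hD, altFn, Function.update_comp_equiv]
      rw [← Finset.mul_sum, Finset.sum_comm]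
      simp only [← Finset.mul_sum, hg, mul_zero, Finset.sum_const_zero]
    simp only [lozB_add_three]
    rw [← Finset.mul_sum, Finset.sum_add_distrib, h _ fun j d => hC.sum_lozBFst_update f j d,
      h _ fun j d => hC.sum_lozBSnd_update f j d, add_zero, mul_zero]

theorem cons_cons_cons_comp_swap {X : Type*} {k : ℕ} (x y z : X) (u : Fin k → X) :
    (Fin.cons x (Fin.cons y (Fin.cons z u : Fin (k + 1) → X) : Fin (k + 2) → X) :
      Fin (k + 3) → X) ∘ Equiv.swap 0 2 = Fin.cons z (Fin.cons y (Fin.cons x u)) := by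
  rw [show (2 : Fin (k + 3)) = Fin.succ (Fin.succ 0) from rfl, cons_comp_swap,
    ← Fin.cons_update, Fin.update_cons_zero, Fin.cons_succ, Fin.cons_zero]

theorem cons_cons_comp_swap {X : Type*} {k : ℕ} (x y : X) (u : Fin k → X) :
    (Fin.cons x (Fin.cons y u : Fin (k + 1) → X) : Fin (k + 2) → X) ∘ Equiv.swap 0 1 =
      Fin.cons y (Fin.cons x u) := by
  rw [show (1 : Fin (k + 2)) = Fin.succ 0 from rfl, cons_comp_swap]
  simp

theorem altFn_eq_neg_of_swap_zero_one {X : Type*} {k : ℕ} {g h : (Fin (k + 2) → X) → ℝ}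
    (H : ∀ x y (u : Fin k → X), g (Fin.cons y (Fin.cons x u)) = h (Fin.cons x (Fin.cons y u)))
    (v : Fin (k + 2) → X) : altFn g v = -altFn h v := by
  refine altFn_eq_neg_of_swap (i := 0) (j := 1) (by simp) (fun w => ?_) v
  rw [← Fin.cons_self_tail w, ← Fin.cons_self_tail (Fin.tail w), cons_cons_comp_swap, H]

theorem altFn_eq_neg_of_swap_zero_two {X : Type*} {k : ℕ} {g h : (Fin (k + 3) → X) → ℝ}
    (H : ∀ x y z (u : Fin k → X), g (Fin.cons z (Fin.cons y (Fin.cons x u))) =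
      h (Fin.cons x (Fin.cons y (Fin.cons z u))))
    (v : Fin (k + 3) → X) : altFn g v = -altFn h v := by
  refine altFn_eq_neg_of_swap (i := 0) (j := 2) (Fin.succ_ne_zero 1).symm (fun w => ?_) v
  rw [← Fin.cons_self_tail w, ← Fin.cons_self_tail (Fin.tail w),
    ← Fin.cons_self_tail (Fin.tail (Fin.tail w)), cons_cons_cons_comp_swap, H]

theorem altFn_lozB_eq_zero (f : Euc n [⋀^Fin (m + 2)]→ₗ[ℝ] ℝ)
    (v : Fin (m + 2) → Euc n) :
    altFn (fun w : Fin (m + 2) → Euc n => lozB hk C f (w 0) (Fin.tail w)) v = 0 := by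
  rcases m with _ | l
  · exact (congrArg (fun g => altFn g v) (funext fun w => lozB_two C f _ _)).trans (altFn_zero v)
  · simp only [lozB_add_three]
    rw [altFn_const_mul, altFn_add, altFn_nested (fun x => lozBFst C f x),
      altFn_nested (fun x => lozBSnd C f x),
      altFn_eq_neg_of_swap_zero_two (g := fun w => lozBFst C f (w 0) (Fin.tail w))
        (h := fun w => lozBSnd C f (w 0) (Fin.tail w)), neg_add_cancel, mul_zero]
    intro x y z u
    simp only [lozBFst, lozBSnd, Fin.cons_zero, Fin.tail_cons]
    rfl

/-- The first summand of the unsymmetrized `C◊f`. -/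
def lozWFst (C : MultilinearMap ℝ (fun _ : Fin 4 => Euc n) ℝ)
    (f : Euc n [⋀^Fin (m + 2)]→ₗ[ℝ] ℝ) (c₁ c₂ : Euc n) (a : Fin (m + 2) → Euc n) : ℝ :=
  ∑ p, C ![c₁, c₂, a 0, eb n p] * f.curryLeft (eb n p) (Fin.tail a)

/-- The second summand of the unsymmetrized `C◊f`. -/
def lozWSnd (C : MultilinearMap ℝ (fun _ : Fin 4 => Euc n) ℝ)
    (f : Euc n [⋀^Fin (m + 2)]→ₗ[ℝ] ℝ) (c₁ c₂ : Euc n) (a : Fin (m + 2) → Euc n) : ℝ :=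
  ∑ p, C ![a 0, Fin.tail a 0, c₁, eb n p] *
    ((f.curryLeft (eb n p)).curryLeft c₂) (Fin.tail (Fin.tail a))

/-- The trace correction of the unsymmetrized `C◊f`. -/
def lozWTrd (hk : 2 ≤ m + 2) (C : MultilinearMap ℝ (fun _ : Fin 4 => Euc n) ℝ)
    (f : Euc n [⋀^Fin (m + 2)]→ₗ[ℝ] ℝ) (c₁ c₂ : Euc n) (a : Fin (m + 2) → Euc n) : ℝ :=
  (((m : ℝ) + 2) / ((n : ℝ) - ((m : ℝ) + 2))) * ⟪c₁, a 0⟫ * lozB hk C f c₂ (Fin.tail a)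

theorem lozW_eq (f : Euc n [⋀^Fin (m + 2)]→ₗ[ℝ] ℝ) (c₁ c₂ : Euc n)
    (a : Fin (m + 2) → Euc n) :
    lozW hk C f c₁ c₂ a = (1 / 2) *
      ((altFn (lozWFst C f c₁ c₂) a + altFn (lozWSnd C f c₁ c₂) a +
        altFn (lozWTrd hk C f c₁ c₂) a) -
      (altFn (lozWFst C f c₂ c₁) a + altFn (lozWSnd C f c₂ c₁) a +
        altFn (lozWTrd hk C f c₂ c₁) a)) := by
  have h : ∀ c₁ c₂ : Euc n, altFn (fun a' : Fin (m + 2) → Euc n =>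
        (∑ p : Fin n,
          C ![c₁, c₂, a' ⟨0, by omega⟩, eb n p] *
            f (fun i => if (i : ℕ) = 0 then eb n p else a' i)) +
        (∑ p : Fin n,
          C ![a' ⟨0, by omega⟩, a' ⟨1, by omega⟩, c₁, eb n p] *
            f (fun i =>
              if (i : ℕ) = 0 then eb n p else if (i : ℕ) = 1 then c₂ else a' i)) +
        (((m + 2 : ℕ) : ℝ) / ((n : ℝ) - ((m + 2 : ℕ) : ℝ))) * ⟪c₁, a' ⟨0, by omega⟩⟫ *
          lozB hk C f c₂ (fun j => a' ⟨(j : ℕ) + 1, by have := j.isLt; omega⟩)) a =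
      altFn (lozWFst C f c₁ c₂) a + altFn (lozWSnd C f c₁ c₂) a +
        altFn (lozWTrd hk C f c₁ c₂) a := by
    intro c₁ c₂
    rw [← altFn_add, ← altFn_add]
    refine congrArg (fun g => altFn g a) (funext fun a' => ?_)
    unfold lozWFst lozWSnd lozWTrd
    congr 1
    · congr 1
      · refine Finset.sum_congr rfl fun p _ => ?_
        congr 1
        rw [← curryLeft_cons]
        congr 1
        funext i
        exact Fin.cases rfl (fun i => rfl) i
      · refine Finset.sum_congr rfl fun p _ => ?_
        congr 1
        rw [← curryLeft_cons, ← curryLeft_cons]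
        congr 1
        funext i
        exact Fin.cases rfl (fun i => Fin.cases rfl (fun i => rfl) i) i
    · push_cast
      rfl
  unfold lozW
  rw [h, h]

theorem lozW_skew {k : ℕ} (hk : 2 ≤ k) (f : Euc n [⋀^Fin k]→ₗ[ℝ] ℝ) (c₁ c₂ : Euc n)
    (a : Fin k → Euc n) : lozW hk C f c₁ c₂ a = -lozW hk C f c₂ c₁ a := by
  unfold lozW
  ring

theorem lozW_perm {k : ℕ} (hk : 2 ≤ k) (f : Euc n [⋀^Fin k]→ₗ[ℝ] ℝ) (c₁ c₂ : Euc n)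
    (σ : Equiv.Perm (Fin k)) (a : Fin k → Euc n) :
    lozW hk C f c₁ c₂ (a ∘ σ) = ((Equiv.Perm.sign σ : ℤ) : ℝ) * lozW hk C f c₁ c₂ a := by
  unfold lozW
  rw [altFn_apply_comp_perm, altFn_apply_comp_perm]
  ring

theorem IsWeyl.lozWFst_swap (hC : IsWeyl C) (f : Euc n [⋀^Fin (m + 2)]→ₗ[ℝ] ℝ)
    (c₁ c₂ : Euc n) (a : Fin (m + 2) → Euc n) :
    lozWFst C f c₂ c₁ a = (-1) * lozWFst C f c₁ c₂ a := by
  simp only [lozWFst, Finset.mul_sum]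
  refine Finset.sum_congr rfl fun p _ => ?_
  rw [hC.1 c₂ c₁]
  ring

/-- Alternating `C◊f` over its last `k + 1` arguments gives zero. -/
theorem IsWeyl.altFn_lozW (hC : IsWeyl C) (f : Euc n [⋀^Fin (m + 2)]→ₗ[ℝ] ℝ)
    (c : Euc n) (v : Fin (m + 3) → Euc n) :
    altFn (fun w => lozW hk C f c (w 0) (Fin.tail w)) v = 0 := by
  have hSndSwap : altFn (fun w : Fin (m + 3) → Euc n => lozWSnd C f (w 0) c (Fin.tail w)) v
      = 0 := by
    have h1 := altFn_eq_neg_of_swap_zero_one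
      (g := fun w : Fin (m + 3) → Euc n => lozWSnd C f (w 0) c (Fin.tail w))
      (h := fun w : Fin (m + 3) → Euc n => ∑ p, C ![w 0, Fin.tail (Fin.tail w) 0,
        Fin.tail w 0, eb n p] * ((f.curryLeft (eb n p)).curryLeft c)
          (Fin.tail (Fin.tail (Fin.tail w)))) (fun x y u => by simp [lozWSnd]) v
    have h2 := altFn_eq_neg_of_swap_zero_two
      (g := fun w : Fin (m + 3) → Euc n => lozWSnd C f (w 0) c (Fin.tail w))
      (h := fun w : Fin (m + 3) → Euc n => ∑ p, C ![Fin.tail w 0, w 0,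
        Fin.tail (Fin.tail w) 0, eb n p] * ((f.curryLeft (eb n p)).curryLeft c)
          (Fin.tail (Fin.tail (Fin.tail w))))
      (fun x y z u => by simp only [lozWSnd, Fin.cons_zero, Fin.tail_cons]) v
    have h3 := altFn_zero (X := Euc n) v
    rw [show (fun _ : Fin (m + 3) → Euc n => (0 : ℝ)) = fun w =>
        lozWSnd C f (w 0) c (Fin.tail w) -
        ((∑ p, C ![w 0, Fin.tail (Fin.tail w) 0, Fin.tail w 0, eb n p] *
          ((f.curryLeft (eb n p)).curryLeft c) (Fin.tail (Fin.tail (Fin.tail w)))) +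
        (∑ p, C ![Fin.tail w 0, w 0, Fin.tail (Fin.tail w) 0, eb n p] *
          ((f.curryLeft (eb n p)).curryLeft c) (Fin.tail (Fin.tail (Fin.tail w))))) from ?_,
      altFn_sub, altFn_add] at h3
    · linarith
    · funext w
      simp only [lozWSnd, ← Finset.sum_add_distrib, ← Finset.sum_sub_distrib]
      refine (Finset.sum_eq_zero fun p _ => ?_).symm
      linear_combination (((f.curryLeft (eb n p)).curryLeft c)
        (Fin.tail (Fin.tail (Fin.tail w)))) * (hC.2.2.1 (Fin.tail w 0)
          (Fin.tail (Fin.tail w) 0) (w 0) (eb n p)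
          - hC.1 (Fin.tail (Fin.tail w) 0) (w 0) (Fin.tail w 0) (eb n p)
          - hC.1 (w 0) (Fin.tail w 0) (Fin.tail (Fin.tail w) 0) (eb n p))
  have hFstSnd : 2 * altFn (fun w : Fin (m + 3) → Euc n => lozWFst C f c (w 0) (Fin.tail w)) v +
      altFn (fun w : Fin (m + 3) → Euc n => lozWSnd C f c (w 0) (Fin.tail w)) v = 0 := by
    have h1 := altFn_eq_neg_of_swap_zero_one
      (g := fun w : Fin (m + 3) → Euc n => lozWFst C f c (w 0) (Fin.tail w))
      (h := fun w : Fin (m + 3) → Euc n => ∑ p, C ![c, Fin.tail w 0, w 0, eb n p] *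
        f.curryLeft (eb n p) (Fin.tail (Fin.tail w))) (fun x y u => by simp [lozWFst]) v
    have h2 := altFn_eq_neg_of_swap_zero_two
      (g := fun w : Fin (m + 3) → Euc n => lozWSnd C f c (w 0) (Fin.tail w))
      (h := fun w : Fin (m + 3) → Euc n => ∑ p, C ![Fin.tail w 0, w 0, c, eb n p] *
        f.curryLeft (eb n p) (Fin.tail (Fin.tail w)))
      (fun x y z u => by
        simp only [lozWSnd, Fin.cons_zero, Fin.tail_cons, ← curryLeft_cons]) v
    have h3 := altFn_zero (X := Euc n) v
    rw [show (fun _ : Fin (m + 3) → Euc n => (0 : ℝ)) = fun w =>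
        lozWFst C f c (w 0) (Fin.tail w) -
        ((∑ p, C ![c, Fin.tail w 0, w 0, eb n p] *
          f.curryLeft (eb n p) (Fin.tail (Fin.tail w))) +
        (∑ p, C ![Fin.tail w 0, w 0, c, eb n p] *
          f.curryLeft (eb n p) (Fin.tail (Fin.tail w)))) from ?_,
      altFn_sub, altFn_add] at h3
    · linarith
    · funext w
      simp only [lozWFst, ← Finset.sum_add_distrib, ← Finset.sum_sub_distrib]
      refine (Finset.sum_eq_zero fun p _ => ?_).symm
      linear_combination (f.curryLeft (eb n p) (Fin.tail (Fin.tail w))) *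
        (hC.2.2.1 c (w 0) (Fin.tail w 0) (eb n p)
          - hC.1 (w 0) (Fin.tail w 0) c (eb n p) - hC.1 (Fin.tail w 0) c (w 0) (eb n p))
  have hTrd : altFn (fun w : Fin (m + 3) → Euc n => lozWTrd hk C f c (w 0) (Fin.tail w)) v
      = 0 := by
    rw [altFn_eq_neg_of_swap_zero_one
      (h := fun w => ((((m : ℝ) + 2) / ((n : ℝ) - ((m : ℝ) + 2))) * ⟪c, w 0⟫) *
        lozB hk C f (Fin.tail w 0) (Fin.tail (Fin.tail w))) (fun x y u => by simp [lozWTrd]) v,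
      ← altFn_nested (fun x d => ((((m : ℝ) + 2) / ((n : ℝ) - ((m : ℝ) + 2))) * ⟪c, x⟫) *
        lozB hk C f (d 0) (Fin.tail d))]
    refine neg_eq_zero.mpr
      ((congrArg (fun g => altFn g v) (funext fun w => ?_)).trans (altFn_zero v))
    exact (altFn_const_mul _ _ _).trans
      ((congrArg _ (altFn_lozB_eq_zero f (Fin.tail w))).trans (mul_zero _))
  have hTrdSwap : altFn (fun w : Fin (m + 3) → Euc n => lozWTrd hk C f (w 0) c (Fin.tail w)) v
      = 0 := by
    have := altFn_eq_neg_of_swap_zero_one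
      (g := fun w : Fin (m + 3) → Euc n => lozWTrd hk C f (w 0) c (Fin.tail w))
      (h := fun w : Fin (m + 3) → Euc n => lozWTrd hk C f (w 0) c (Fin.tail w))
      (fun x y u => by simp [lozWTrd, real_inner_comm]) v
    linarith
  simp only [lozW_eq, funext (hC.lozWFst_swap f c _)]
  rw [altFn_const_mul, altFn_sub, altFn_add, altFn_add, altFn_add, altFn_add]
  simp only [altFn_const_mul]
  rw [altFn_nested (fun x => lozWFst C f c x), altFn_nested (fun x => lozWSnd C f c x),
    altFn_nested (fun x => lozWTrd hk C f c x), altFn_nested (fun x => lozWSnd C f x c),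
    altFn_nested (fun x => lozWTrd hk C f x c)]
  linarith

theorem IsWeyl.contract_curryLeft (hC : IsWeyl C) (f : Euc n [⋀^Fin (m + 2)]→ₗ[ℝ] ℝ)
    (x y : Euc n) (u : Fin m → Euc n) :
    ∑ i, ∑ p, C ![eb n i, x, y, eb n p] * ((f.curryLeft (eb n p)).curryLeft (eb n i)) u =
      (1 / 2) * ∑ p, ∑ q, C ![x, y, eb n p, eb n q] *
        ((f.curryLeft (eb n p)).curryLeft (eb n q)) u := by
  have hF : ∀ i p, ((f.curryLeft (eb n p)).curryLeft (eb n i)) u =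
      -((f.curryLeft (eb n i)).curryLeft (eb n p)) u := fun i p => by
    rw [f.curryLeft_curryLeft_swap, AlternatingMap.neg_apply]
  rw [hC.contract_skew (H := fun i p => ((f.curryLeft (eb n p)).curryLeft (eb n i)) u) hF]
  congr 1
  refine Finset.sum_congr rfl fun i _ => Finset.sum_congr rfl fun p _ => ?_
  rw [hC.1 y x, hF i p, neg_mul_neg]

theorem IsWeyl.sum_lozWFst (hC : IsWeyl C) (f : Euc n [⋀^Fin (m + 2)]→ₗ[ℝ] ℝ)
    (c : Euc n) (d : Fin (m + 1) → Euc n) :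
    ∑ i, altFn (lozWFst C f (eb n i) c) (Fin.cons (eb n i) d) =
      -(((m : ℝ) + 1) / (2 * ((m : ℝ) + 2))) * altFn (lozBFst C f c) d := by
  have hm : (m : ℝ) + 2 ≠ 0 := by positivity
  have hcons : ∀ i, altFn (lozWFst C f (eb n i) c) (Fin.cons (eb n i) d) = _ := fun i =>
    altFn_cons_of_alternating (φ := fun y u =>
      ∑ p, C ![eb n i, c, y, eb n p] * f.curryLeft (eb n p) u)
      (fun y σ w => by
        rw [Finset.mul_sum]
        refine Finset.sum_congr rfl fun p _ => ?_
        rw [AlternatingMap.map_perm_real]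
        ring) (eb n i) d
  have htrace : ∑ i, ∑ p, C ![eb n i, c, eb n i, eb n p] * f.curryLeft (eb n p) d = 0 := by
    rw [Finset.sum_comm]
    simp only [← Finset.sum_mul, hC.2.2.2, zero_mul, Finset.sum_const_zero]
  simp only [hcons, curryLeft_cons]
  rw [← Finset.mul_sum, Finset.sum_sub_distrib, htrace, ← Finset.mul_sum, ← altFn_sum]
  simp only [hC.contract_curryLeft]
  rw [altFn_const_mul]
  change 1 / ((m : ℝ) + 2) * (0 - ((m : ℝ) + 1) * (1 / 2 * altFn (lozBFst C f c) d)) = _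
  field_simp
  ring

theorem IsWeyl.sum_lozWSnd_swap (hC : IsWeyl C) (f : Euc n [⋀^Fin (m + 2)]→ₗ[ℝ] ℝ)
    (c : Euc n) (d : Fin (m + 1) → Euc n) :
    ∑ i, altFn (lozWSnd C f c (eb n i)) (Fin.cons (eb n i) d) =
      -(1 / ((m : ℝ) + 2)) * altFn (lozBFst C f c) d := by
  have hm : (m : ℝ) + 2 ≠ 0 := by positivity
  have hzero : ∀ (x : Euc n) (j : Fin m) (d' : Fin (m + 1) → Euc n),
      lozWSnd C f c x (Fin.cons (d' j.succ) (Function.update d' j.succ x)) = 0 := by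
    intro x j d'
    refine Finset.sum_eq_zero fun p _ => ?_
    rw [Fin.tail_cons, Fin.tail_update_succ, ← curryLeft_cons,
      AlternatingMap.map_eq_zero_of_eq _ _ (i := 0) (j := j.succ)
        (by simp) (Fin.succ_ne_zero _).symm, mul_zero]
  have hfront : ∀ d' : Fin (m + 1) → Euc n,
      ∑ i, lozWSnd C f c (eb n i) (Fin.cons (eb n i) d') = (-1 / 2) * lozBFst C f c d' := by
    intro d'
    simp only [lozWSnd, Fin.cons_zero, Fin.tail_cons, lozBFst]
    rw [hC.contract_curryLeft, Finset.mul_sum, Finset.mul_sum]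
    refine Finset.sum_congr rfl fun p _ => ?_
    rw [Finset.mul_sum, Finset.mul_sum]
    refine Finset.sum_congr rfl fun q _ => ?_
    rw [hC.1 c]
    ring
  have hsecond : ∀ d' : Fin (m + 1) → Euc n,
      ∑ i, lozWSnd C f c (eb n i) (Fin.cons (d' 0) (Function.update d' 0 (eb n i))) =
        (1 / 2) * lozBFst C f c d' := by
    intro d'
    have := hfront d'
    simp only [lozWSnd, Fin.cons_zero, Fin.tail_cons, Function.update_self,
      Fin.tail_update_zero, hC.1 (d' 0), neg_mul, Finset.sum_neg_distrib] at this ⊢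
    linarith
  simp only [altFn_cons, Fin.sum_univ_succ, hzero, altFn_zero, Finset.sum_const_zero, add_zero]
  rw [← Finset.mul_sum, Finset.sum_sub_distrib, ← altFn_sum, ← altFn_sum]
  simp only [hfront, hsecond, altFn_const_mul]
  push_cast
  rw [add_assoc, one_add_one_eq_two]
  ring

theorem IsWeyl.sum_lozWSnd (hC : IsWeyl C) (f : Euc n [⋀^Fin (m + 2)]→ₗ[ℝ] ℝ)
    (c : Euc n) (d : Fin (m + 1) → Euc n) :
    ∑ i, altFn (lozWSnd C f (eb n i) c) (Fin.cons (eb n i) d) =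
      ((m : ℝ) / ((m : ℝ) + 2)) * altFn (lozBFst C f c) d - lozB hk C f c d := by
  have hfront : ∀ d' : Fin (m + 1) → Euc n,
      ∑ i, lozWSnd C f (eb n i) c (Fin.cons (eb n i) d') = 0 := by
    intro d'
    simp only [lozWSnd, Fin.cons_zero, Fin.tail_cons]
    rw [Finset.sum_comm]
    simp only [← Finset.sum_mul, hC.2.2.2, zero_mul, Finset.sum_const_zero]
  have hsecond : ∀ d' : Fin (m + 1) → Euc n,
      ∑ i, lozWSnd C f (eb n i) c (Fin.cons (d' 0) (Function.update d' 0 (eb n i))) = 0 := by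
    intro d'
    have := hfront d'
    simp only [lozWSnd, Fin.cons_zero, Fin.tail_cons, Function.update_self,
      Fin.tail_update_zero, hC.1 (d' 0), neg_mul, Finset.sum_neg_distrib] at this ⊢
    linarith
  have hreduce : ∑ i, altFn (lozWSnd C f (eb n i) c) (Fin.cons (eb n i) d) =
      -(1 / ((m : ℝ) + 2)) * ∑ j : Fin m, altFn (fun d' => ∑ i, lozWSnd C f (eb n i) c
        (Fin.cons (d' j.succ) (Function.update d' j.succ (eb n i)))) d := by
    simp only [altFn_cons, Fin.sum_univ_succ]
    rw [← Finset.mul_sum, Finset.sum_sub_distrib, Finset.sum_add_distrib, ← altFn_sum,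
      ← altFn_sum, Finset.sum_comm]
    simp only [hfront, hsecond, altFn_zero, ← altFn_sum]
    push_cast
    rw [add_assoc, one_add_one_eq_two]
    ring
  rw [hreduce]
  rcases m with _ | l
  · rw [lozB_two]
    simp
  have hl : (l : ℝ) + 3 ≠ 0 := by positivity
  have hmove : ∀ j : Fin (l + 1), altFn (fun d' => ∑ i, lozWSnd C f (eb n i) c
      (Fin.cons (d' j.succ) (Function.update d' j.succ (eb n i)))) d =
      altFn (lozBSnd C f c) d := by
    intro j
    have hswap : ∀ (i : Fin n) (z : Euc n) (t : Fin (l + 1) → Euc n),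
        altFn (fun t => ∑ p, C ![t j, z, eb n i, eb n p] *
          ((f.curryLeft (eb n p)).curryLeft c) (Function.update t j (eb n i))) t =
        altFn (fun t => ∑ p, C ![t 0, z, eb n i, eb n p] *
          ((f.curryLeft (eb n p)).curryLeft c) (Function.update t 0 (eb n i))) t :=
      fun i z t => altFn_update (φ := fun y u => ∑ p, C ![y, z, eb n i, eb n p] *
          ((f.curryLeft (eb n p)).curryLeft c) u)
        (fun y σ w => by
          rw [Finset.mul_sum]
          refine Finset.sum_congr rfl fun p _ => ?_
          rw [AlternatingMap.map_perm_real]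
          ring) (eb n i) t j
    simp only [lozWSnd, Fin.cons_zero, Fin.tail_cons, Fin.tail_update_succ,
      Function.update_of_ne (Fin.succ_ne_zero j).symm]
    rw [altFn_sum]
    have hterm : ∀ i, altFn (fun d' : Fin (l + 2) → Euc n =>
        ∑ p, C ![d' j.succ, d' 0, eb n i, eb n p] *
          ((f.curryLeft (eb n p)).curryLeft c) (Function.update (Fin.tail d') j (eb n i))) d =
        altFn (fun d' : Fin (l + 2) → Euc n =>
          ∑ p, C ![Fin.tail d' 0, d' 0, eb n i, eb n p] * ((f.curryLeft (eb n p)).curryLeft c)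
            (Function.update (Fin.tail d') 0 (eb n i))) d := by
      intro i
      have h := altFn_nested (fun z (t : Fin (l + 1) → Euc n) =>
        ∑ p, C ![t j, z, eb n i, eb n p] *
          ((f.curryLeft (eb n p)).curryLeft c) (Function.update t j (eb n i))) d
      simp only [hswap] at h
      rw [altFn_nested (fun z (t : Fin (l + 1) → Euc n) =>
        ∑ p, C ![t 0, z, eb n i, eb n p] *
          ((f.curryLeft (eb n p)).curryLeft c) (Function.update t 0 (eb n i)))] at h
      exact h.symm
    rw [Finset.sum_congr rfl fun i _ => hterm i, ← altFn_sum]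
    refine congrArg (fun g => altFn g d) (funext fun d' => ?_)
    refine Finset.sum_congr rfl fun i _ => Finset.sum_congr rfl fun p _ => ?_
    rw [update_zero_eq_cons, curryLeft_cons, ← curryLeft_cyclic]
  simp only [hmove, Finset.sum_const, Finset.card_univ, Fintype.card_fin, nsmul_eq_mul]
  rw [lozB_add_three]
  push_cast
  rw [show (l : ℝ) + 1 + 2 = l + 3 by ring]
  field_simp
  ring

theorem sum_lozWTrd (f : Euc n [⋀^Fin (m + 2)]→ₗ[ℝ] ℝ) (c : Euc n)
    (d : Fin (m + 1) → Euc n) :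
    ∑ i, altFn (lozWTrd hk C f (eb n i) c) (Fin.cons (eb n i) d) =
      (1 / ((m : ℝ) + 2)) * ((((m : ℝ) + 2) / ((n : ℝ) - ((m : ℝ) + 2))) *
        ((n : ℝ) - ((m : ℝ) + 1)) * lozB hk C f c d) := by
  have hcons : ∀ i, altFn (lozWTrd hk C f (eb n i) c) (Fin.cons (eb n i) d) = _ := fun i =>
    altFn_cons_of_alternating (φ := fun y u => (((m : ℝ) + 2) / ((n : ℝ) - ((m : ℝ) + 2))) *
      ⟪eb n i, y⟫ * lozB hk C f c u)
      (fun y σ w => by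
        rw [show lozB hk C f c (w ∘ σ) = _ from lozB_perm hk C f c σ w]
        ring) (eb n i) d
  have hsum : ∀ d' : Fin (m + 1) → Euc n,
      ∑ i, ⟪eb n i, d' 0⟫ * lozB hk C f c (Fin.cons (eb n i) (Fin.tail d') : Fin (m + 1) → Euc n)
        = lozB hk C f c d' := by
    intro d'
    have := sum_inner_mul_eb' (isLinearMap_lozB_update (hk := hk) C f c 0 d') (d' 0)
    simpa only [Function.update_eq_self, update_zero_eq_cons] using this
  simp only [hcons, inner_eb_self, mul_assoc, altFn_const_mul]
  rw [← Finset.mul_sum, Finset.sum_sub_distrib, ← Finset.mul_sum, ← Finset.mul_sum,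
    ← Finset.mul_sum, ← Finset.mul_sum, ← altFn_sum]
  simp only [hsum, Finset.sum_const, Finset.card_univ, Fintype.card_fin, nsmul_eq_mul]
  rw [altFn_eq_self fun σ w => lozB_perm hk C f c σ w]
  ring

theorem IsWeyl.sum_lozWTrd_swap (hC : IsWeyl C) (f : Euc n [⋀^Fin (m + 2)]→ₗ[ℝ] ℝ)
    (c : Euc n) (d : Fin (m + 1) → Euc n) :
    ∑ i, altFn (lozWTrd hk C f c (eb n i)) (Fin.cons (eb n i) d) =
      (1 / ((m : ℝ) + 2)) * ((((m : ℝ) + 2) / ((n : ℝ) - ((m : ℝ) + 2))) *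
        lozB hk C f c d) := by
  have hcons : ∀ i, altFn (lozWTrd hk C f c (eb n i)) (Fin.cons (eb n i) d) = _ := fun i =>
    altFn_cons_of_alternating (φ := fun y u => (((m : ℝ) + 2) / ((n : ℝ) - ((m : ℝ) + 2))) *
      ⟪c, y⟫ * lozB hk C f (eb n i) u)
      (fun y σ w => by
        rw [show lozB hk C f (eb n i) (w ∘ σ) = _ from lozB_perm hk C f (eb n i) σ w]
        ring) (eb n i) d
  simp only [hcons, mul_assoc, altFn_const_mul]
  rw [← Finset.mul_sum, Finset.sum_sub_distrib, ← Finset.mul_sum, ← Finset.mul_sum,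
    ← Finset.mul_sum, ← altFn_sum]
  simp only [← Finset.mul_sum, hC.sum_lozB_cons, mul_zero, altFn_zero,
    sum_inner_mul_eb (isLinearMap_lozB (hk := hk) C f d), sub_zero]

/-- The tensor `C◊f` is trace-free. -/
theorem IsWeyl.sum_lozW_cons (hC : IsWeyl C) (hn : m + 2 ≤ n - 1)
    (f : Euc n [⋀^Fin (m + 2)]→ₗ[ℝ] ℝ) (c : Euc n) (d : Fin (m + 1) → Euc n) :
    ∑ i, lozW hk C f (eb n i) c (Fin.cons (eb n i) d : Fin (m + 2) → Euc n) = 0 := by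
  have hm : (m : ℝ) + 2 ≠ 0 := by positivity
  have hnm : (n : ℝ) - ((m : ℝ) + 2) ≠ 0 := by
    have : (m : ℝ) + 2 < n := by exact_mod_cast (show m + 2 < n by omega)
    linarith
  have hFstSwap : ∑ i, altFn (lozWFst C f c (eb n i)) (Fin.cons (eb n i) d) =
      (-1) * ∑ i, altFn (lozWFst C f (eb n i) c) (Fin.cons (eb n i) d) := by
    rw [Finset.mul_sum]
    refine Finset.sum_congr rfl fun i _ => ?_
    rw [← altFn_const_mul]
    exact congrArg (fun g => altFn g _) (funext fun a => hC.lozWFst_swap f _ _ a)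
  simp only [lozW_eq]
  rw [← Finset.mul_sum, Finset.sum_sub_distrib, Finset.sum_add_distrib, Finset.sum_add_distrib,
    Finset.sum_add_distrib, Finset.sum_add_distrib, hFstSwap, hC.sum_lozWFst,
    hC.sum_lozWSnd (hk := hk), hC.sum_lozWSnd_swap, sum_lozWTrd, hC.sum_lozWTrd_swap]
  field_simp
  ring

end WhiteLozenge

/-- For a Weyl-type tensor `C` and an alternating `k`-linear `f`
(`2 ≤ k ≤ n-1`), `G = C◊f` lies in `E(2,k)₀`: (a) for fixed `c₁` the alternation of `G`
over `(c₂,a₁,…,a_k)` vanishes; (b) for fixed `a_k` the alternation of `G` over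
`(c₁,c₂,a₁,…,a_{k-1})` vanishes; (c) `G` is trace-free. -/
theorem weyl_white_lozenge_in_E2k0
    (n k : ℕ) (hk : 2 ≤ k) (hkn : k ≤ n - 1)
    (C : MultilinearMap ℝ (fun _ : Fin 4 => Euc n) ℝ) (hC : IsWeyl C)
    (f : (Euc n) [⋀^Fin k]→ₗ[ℝ] ℝ) :
    (∀ (c₁ : Euc n) (v : Fin (k + 1) → Euc n),
      altFn (fun w => lozW hk C f c₁ (w 0) (Fin.tail w)) v = 0) ∧
    (∀ (alast : Euc n) (v : Fin (k + 1) → Euc n),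
      altFn (fun w => lozW hk C f (w 0) (w 1)
        (fun j : Fin k =>
          if h : (j : ℕ) < k - 1 then w ⟨(j : ℕ) + 2, by have := j.isLt; omega⟩
          else alast)) v = 0) ∧
    (∀ (c₂ : Euc n) (d : Fin (k - 1) → Euc n),
      ∑ i : Fin n, lozW hk C f (eb n i) c₂ (consCast (eb n i) d) = 0) := by
  obtain ⟨m, rfl⟩ : ∃ m, k = m + 2 := ⟨k - 2, by omega⟩
  refine ⟨fun c v => hC.altFn_lozW f c v, fun z v => ?_, fun c d => ?_⟩
  · rw [← altFn_fixed_last_argument (G := fun x y u => lozW hk C f x y u) (lozW_skew hk f)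
      (lozW_perm hk f) (fun x v => hC.altFn_lozW f x v) z v]
    refine congrArg (fun g => altFn g v) (funext fun w => congrArg _ (funext fun j => ?_))
    unfold Fin.snoc
    split_ifs with h₁ h₂ h₂
    · rfl
    · exact absurd h₁ h₂
    · exact absurd h₂ h₁
    · rfl
  · have h : ∀ x : Euc n, consCast x d = (Fin.cons x d : Fin (m + 2) → Euc n) :=
      fun x => funext fun j => Fin.cases rfl (fun j => rfl) j
    simp only [h]
    exact hC.sum_lozW_cons hkn f c d
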